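/- Let V be a 2n-dimensional real vector space with a nondegenerate alternating bilinear form ω, and let *_s : Λᵏ(V*) → Λ^{2n-k}(V*) be the symplectic star defined by α ∧ *_s β = ω⁻¹(α, β) ωⁿ/n! for all α, β ∈ Λᵏ(V*). Then *_s ∘ *_s = id. -/

import Mathlib

open ExteriorAlgebra

namespace SympStar

/-- The degree `k` part of the exterior algebra. -/
abbrev Lam (M : Type) [AddCommGroup M] [Module ℝ M] (k : ℕ) :
    Submodule ℝ (ExteriorAlgebra ℝ M) :=
  LinearMap.range (ExteriorAlgebra.ι ℝ : M →ₗ[ℝ] ExteriorAlgebra ℝ M) ^ k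

/-- Contraction with a functional. -/
noncomputable def ctr {M : Type} [AddCommGroup M] [Module ℝ M] (d : Module.Dual ℝ M) :
    ExteriorAlgebra ℝ M →ₗ[ℝ] ExteriorAlgebra ℝ M :=
  CliffordAlgebra.contractLeft (Q := (0 : QuadraticForm ℝ M)) d

section
variable {M : Type} [AddCommGroup M] [Module ℝ M]

theorem ctr_mul (d : Module.Dual ℝ M) (a : M) (x : ExteriorAlgebra ℝ M) :
    ctr d (ι ℝ a * x) = d a • x - ι ℝ a * ctr d x :=
  CliffordAlgebra.contractLeft_ι_mul d a x

theorem ctr_alg (d : Module.Dual ℝ M) (r : ℝ) :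
    ctr d (algebraMap ℝ (ExteriorAlgebra ℝ M) r) = 0 :=
  CliffordAlgebra.contractLeft_algebraMap _ d r

theorem ctr_one (d : Module.Dual ℝ M) : ctr d (1 : ExteriorAlgebra ℝ M) = 0 :=
  CliffordAlgebra.contractLeft_one _ d

theorem ctr_ι (d : Module.Dual ℝ M) (a : M) :
    ctr d (ι ℝ a) = algebraMap ℝ (ExteriorAlgebra ℝ M) (d a) :=
  CliffordAlgebra.contractLeft_ι _ d a

theorem ctr_neg (d : Module.Dual ℝ M) (x : ExteriorAlgebra ℝ M) :
    ctr (-d) x = - ctr d x := by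
  simp [ctr]

theorem mul_mem_Lam (a : M) {k : ℕ} {x : ExteriorAlgebra ℝ M} (hx : x ∈ Lam M k) :
    ι ℝ a * x ∈ Lam M (k + 1) := by
  rw [Lam, pow_succ']
  exact Submodule.mul_mem_mul ⟨a, rfl⟩ hx

theorem mul_mem_Lam' {j k : ℕ} {x y : ExteriorAlgebra ℝ M} (hx : x ∈ Lam M j)
    (hy : y ∈ Lam M k) : x * y ∈ Lam M (j + k) := by
  rw [Lam, pow_add]
  exact Submodule.mul_mem_mul hx hy

theorem alg_mem (r : ℝ) : algebraMap ℝ (ExteriorAlgebra ℝ M) r ∈ Lam M 0 := by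
  rw [Lam, pow_zero]
  exact Submodule.algebraMap_mem r

theorem ι_mem (a : M) : ι ℝ a ∈ Lam M 1 := by
  rw [Lam, pow_one]; exact ⟨a, rfl⟩

@[elab_as_elim]
theorem Lam_ind {P : ∀ (k : ℕ) (x : ExteriorAlgebra ℝ M), x ∈ Lam M k → Prop}
    (h0 : ∀ r, P 0 (algebraMap ℝ _ r) (alg_mem r))
    (hadd : ∀ k x y hx hy, P k x hx → P k y hy → P k (x + y) (Submodule.add_mem _ hx hy))
    (hmul : ∀ a k x hx, P k x hx → P (k + 1) (ι ℝ a * x) (mul_mem_Lam a hx))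
    (k : ℕ) (x : ExteriorAlgebra ℝ M) (hx : x ∈ Lam M k) : P k x hx := by
  refine Submodule.pow_induction_on_left' _ (C := P) h0
    (fun x y i hx hy => hadd i x y hx hy) ?_ hx
  rintro m ⟨a, rfl⟩ i x hx h
  exact hmul a i x hx h

theorem ctr_mem (d : Module.Dual ℝ M) {k : ℕ} {x : ExteriorAlgebra ℝ M}
    (hx : x ∈ Lam M k) : (∀ j, k = j + 1 → ctr d x ∈ Lam M j) ∧ (k = 0 → ctr d x = 0) := by
  induction k, x, hx using Lam_ind with
  | h0 r => exact ⟨by intro j hj; omega, fun _ => ctr_alg d r⟩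
  | hadd k x y _ _ hx hy =>
    refine ⟨fun j hj => ?_, fun h => ?_⟩
    · rw [map_add]; exact Submodule.add_mem _ (hx.1 j hj) (hy.1 j hj)
    · rw [map_add, hx.2 h, hy.2 h, add_zero]
  | hmul a k x hx ih =>
    refine ⟨fun j hj => ?_, fun h => by omega⟩
    obtain rfl : k = j := by omega
    rw [ctr_mul]
    refine Submodule.sub_mem _ (Submodule.smul_mem _ _ hx) ?_
    cases k with
    | zero => rw [ih.2 rfl, mul_zero]; exact Submodule.zero_mem _
    | succ i => exact mul_mem_Lam a (ih.1 i rfl)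

theorem ctr_mul' (d : Module.Dual ℝ M) {k : ℕ} {x : ExteriorAlgebra ℝ M}
    (hx : x ∈ Lam M k) (y : ExteriorAlgebra ℝ M) :
    ctr d (x * y) = ctr d x * y + (-1 : ℝ) ^ k • (x * ctr d y) := by
  induction k, x, hx using Lam_ind with
  | h0 r => simp [ctr_alg, ← Algebra.smul_def]
  | hadd k x x' _ _ hx hy => simp only [add_mul, map_add, hx, hy, smul_add]; abel
  | hmul a k x hx ih =>
    rw [mul_assoc, ctr_mul, ih, ctr_mul, sub_mul, mul_add, smul_mul_assoc, mul_assoc, mul_smul_comm,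
      pow_succ, mul_neg_one, neg_smul, mul_assoc]
    abel

theorem ι_swap (a b : M) : ι ℝ a * ι ℝ b = - (ι ℝ b * ι ℝ a) :=
  eq_neg_of_add_eq_zero_left (ExteriorAlgebra.ι_add_mul_swap a b)

theorem Lam_comm (a : M) {k : ℕ} {x : ExteriorAlgebra ℝ M} (hx : x ∈ Lam M k) :
    ι ℝ a * x = (-1 : ℝ) ^ k • (x * ι ℝ a) := by
  induction k, x, hx using Lam_ind with
  | h0 r => simp [Algebra.commutes]
  | hadd k x x' _ _ hx hy => simp only [add_mul, mul_add, hx, hy, smul_add]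
  | hmul b k x hx ih =>
    rw [← mul_assoc, ι_swap, neg_mul, mul_assoc, ih, pow_succ, mul_neg_one, neg_smul,
      mul_smul_comm, mul_assoc]

theorem Lam_span {k : ℕ} : Lam M k = Submodule.span ℝ (Set.range (ιMulti ℝ k (M := M))) :=
  (ιMulti_span_fixedDegree ℝ k).symm

theorem Lam_top [FiniteDimensional ℝ M] {k : ℕ} (hk : Module.finrank ℝ M < k)
    {x : ExteriorAlgebra ℝ M} (hx : x ∈ Lam M k) : x = 0 := by
  rw [Lam_span] at hx
  induction hx using Submodule.span_induction with
  | mem x h =>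
    obtain ⟨v, rfl⟩ := h
    refine AlternatingMap.map_linearDependent _ _ fun h => ?_
    have := h.fintype_card_le_finrank
    simp at this
    omega
  | zero => rfl
  | add x y _ _ hx hy => rw [hx, hy, add_zero]
  | smul r x _ hx => rw [hx, smul_zero]

theorem ctr_ιMulti (d : Module.Dual ℝ M) {k : ℕ} (v : Fin (k + 1) → M) :
    ctr d (ιMulti ℝ (k + 1) v) =
      ∑ i : Fin (k + 1), ((-1 : ℝ) ^ (i : ℕ) * d (v i)) • ιMulti ℝ k (fun j => v (i.succAbove j)) := by
  induction k with
  | zero => simp [ctr_ι, Algebra.algebraMap_eq_smul_one]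
  | succ k ih =>
    rw [ιMulti_succ_apply, ctr_mul, ih, Finset.mul_sum,
      Fin.sum_univ_succ (n := k + 1), sub_eq_add_neg,
      ← Finset.sum_neg_distrib]
    congr 1
    · simp [Matrix.vecTail, Function.comp_def]
    · refine Finset.sum_congr rfl fun i _ => ?_
      rw [ιMulti_succ_apply (fun j => v (i.succ.succAbove j)), mul_smul_comm, ← neg_smul]
      congr 1
      · simp [Matrix.vecTail, pow_succ]
      · simp [Matrix.vecTail, Function.comp_def]

variable (w : LinearMap.BilinForm ℝ M) (B : ℕ → LinearMap.BilinForm ℝ (ExteriorAlgebra ℝ M))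
    (hB : ∀ k : ℕ, ∀ α β : Fin k → M,
      B k (ιMulti ℝ k α) (ιMulti ℝ k β) = Matrix.det (Matrix.of fun i j => w (α i) (β j)))

include hB in
theorem B_right (v : M) {k : ℕ} {x y : ExteriorAlgebra ℝ M} (hx : x ∈ Lam M (k + 1))
    (hy : y ∈ Lam M k) : B (k + 1) x (ι ℝ v * y) = B k (ctr (w.flip v) x) y := by
  rw [Lam_span] at hx hy
  induction hx using Submodule.span_induction with
  | zero => simp
  | add x y _ _ hx hy => simp [hx, hy]
  | smul r x _ hx => simp [hx]
  | mem x h =>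
    obtain ⟨a, rfl⟩ := h
    induction hy using Submodule.span_induction with
    | zero => simp
    | add x y _ _ hx hy => simp only [hx, hy, mul_add, map_add]
    | smul r x _ hx => simp only [hx, mul_smul_comm, map_smul]
    | mem x h =>
      obtain ⟨b, rfl⟩ := h
      have : ι ℝ v * ιMulti ℝ k b = ιMulti ℝ (k + 1) (Matrix.vecCons v b) := by
        rw [ιMulti_succ_apply]; simp
      rw [this, hB, Matrix.det_succ_column_zero, ctr_ιMulti, map_sum, LinearMap.sum_apply]
      refine Finset.sum_congr rfl fun i _ => ?_
      rw [map_smul, LinearMap.smul_apply, hB, smul_eq_mul]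
      rfl

include hB in
theorem B_left (v : M) {k : ℕ} {x y : ExteriorAlgebra ℝ M} (hx : x ∈ Lam M (k + 1))
    (hy : y ∈ Lam M k) : B (k + 1) (ι ℝ v * y) x = B k y (ctr (w v) x) := by
  rw [Lam_span] at hx hy
  induction hx using Submodule.span_induction with
  | zero => simp
  | add x y _ _ hx hy => simp [hx, hy]
  | smul r x _ hx => simp [hx]
  | mem x h =>
    obtain ⟨a, rfl⟩ := h
    induction hy using Submodule.span_induction with
    | zero => simp
    | add x y _ _ hx hy => simp only [hx, hy, mul_add, map_add, LinearMap.add_apply]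
    | smul r x _ hx => simp only [hx, mul_smul_comm, map_smul, LinearMap.smul_apply]
    | mem x h =>
      obtain ⟨b, rfl⟩ := h
      have : ι ℝ v * ιMulti ℝ k b = ιMulti ℝ (k + 1) (Matrix.vecCons v b) := by
        rw [ιMulti_succ_apply]; simp
      rw [this, hB, Matrix.det_succ_row_zero, ctr_ιMulti, map_sum]
      refine Finset.sum_congr rfl fun i _ => ?_
      rw [map_smul, hB, smul_eq_mul]
      rfl

theorem deg_two_rep {s : ExteriorAlgebra ℝ M} (hs : s ∈ Lam M 2) :
    ∃ (m : ℕ) (e f : Fin m → M), s = ∑ i, ι ℝ (e i) * ι ℝ (f i) := by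
  rw [Lam, pow_two] at hs
  refine Submodule.mul_induction_on hs ?_ ?_
  · intro x hx y hy
    obtain ⟨a, rfl⟩ := hx
    obtain ⟨b, rfl⟩ := hy
    exact ⟨1, fun _ => a, fun _ => b, by simp⟩
  · intro x y hx hy
    obtain ⟨m, e, f, rfl⟩ := hx
    obtain ⟨m', e', f', rfl⟩ := hy
    exact ⟨m + m', Fin.append e e', Fin.append f f', by simp [Fin.sum_univ_add]⟩

end
end SympStar
namespace SympStar
section
variable {M : Type} [AddCommGroup M] [Module ℝ M]
  (w : LinearMap.BilinForm ℝ M) (hsk : ∀ u v, w u v = - w v u)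
  {m : ℕ} (e f : Fin m → M)

/-- The element of degree two attached to `e`, `f`. -/
noncomputable def two : ExteriorAlgebra ℝ M := ∑ i, ι ℝ (e i) * ι ℝ (f i)

theorem two_mem : two e f ∈ Lam M 2 :=
  Submodule.sum_mem _ fun i _ => mul_mem_Lam (e i) (ι_mem (f i))

theorem ctr_two_aux (d : Module.Dual ℝ M) :
    ctr d (two e f) = ι ℝ (∑ i, (d (e i) • f i - d (f i) • e i)) := by
  simp only [two, map_sum, map_sub, map_smul, ctr_mul, ctr_ι, ← Algebra.commutes,
    ← Algebra.smul_def]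

theorem two_pow_mem (j : ℕ) : two e f ^ j ∈ Lam M (2 * j) := by
  rw [Lam, pow_mul]
  exact Submodule.pow_mem_pow _ (two_mem e f) j

section
variable (hid : ∀ u, ∑ i, (w (e i) u • f i - w (f i) u • e i) = u)

include hid in
theorem ctr_two (u : M) : ctr (w.flip u) (two e f) = ι ℝ u := by
  rw [ctr_two_aux]
  exact congrArg _ (hid u)

include hid in
theorem ctr_two_pow (u : M) (j : ℕ) :
    ctr (w.flip u) (two e f ^ (j + 1)) = ((j : ℝ) + 1) • (ι ℝ u * two e f ^ j) := by
  induction j with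
  | zero => simp [ctr_two w e f hid]
  | succ j ih =>
    have hc : two e f * ι ℝ u = ι ℝ u * two e f := by
      rw [Lam_comm u (two_mem e f)]; simp
    rw [pow_succ', ctr_mul' _ (two_mem e f), ih, ctr_two w e f hid, mul_smul_comm, ← mul_assoc, hc,
      mul_assoc, ← pow_succ']
    push_cast
    module

include hid hsk in
theorem trace_two [FiniteDimensional ℝ M] {n : ℕ} (hdim : Module.finrank ℝ M = 2 * n) :
    ∑ i, w (e i) (f i) = n := by
  have h : (∑ i, ((w (e i)).smulRight (f i) - (w (f i)).smulRight (e i))) = LinearMap.id := by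
    ext u
    simp only [LinearMap.sum_apply, LinearMap.sub_apply, LinearMap.smulRight_apply, hid,
      LinearMap.id_apply]
  have h2 := congrArg (LinearMap.trace ℝ M) h
  rw [LinearMap.trace_id, hdim, map_sum] at h2
  simp only [map_sub, LinearMap.trace_smulRight] at h2
  have h3 : ∀ i, w (e i) (f i) - w (f i) (e i) = 2 * w (e i) (f i) := by
    intro i; rw [hsk (f i) (e i)]; ring
  simp only [h3, ← Finset.mul_sum] at h2
  push_cast at h2
  linarith

variable (B : ℕ → LinearMap.BilinForm ℝ (ExteriorAlgebra ℝ M))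
    (hB : ∀ k : ℕ, ∀ α β : Fin k → M,
      B k (ιMulti ℝ k α) (ιMulti ℝ k β) = Matrix.det (Matrix.of fun i j => w (α i) (β j)))

include hid hsk hB in
theorem B_two_pow_succ [FiniteDimensional ℝ M] {n : ℕ} (hdim : Module.finrank ℝ M = 2 * n) (j : ℕ) :
    B (2 * (j + 1)) (two e f ^ (j + 1)) (two e f ^ (j + 1)) =
      ((j : ℝ) + 1) * (n - j) * B (2 * j) (two e f ^ j) (two e f ^ j) := by
  set s := two e f with hs
  have hx : s ^ (j + 1) ∈ Lam M (2 * j + 1 + 1) := two_pow_mem e f (j + 1)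
  have hy : s ^ j ∈ Lam M (2 * j) := two_pow_mem e f j
  have h1 : s ^ (j + 1) = ∑ i, ι ℝ (e i) * (ι ℝ (f i) * s ^ j) := by
    rw [pow_succ']
    nth_rw 1 [hs]
    rw [two, Finset.sum_mul]
    simp only [mul_assoc]
  have h2 : ∀ i, B (2 * j + 1 + 1) (s ^ (j + 1)) (ι ℝ (e i) * (ι ℝ (f i) * s ^ j)) =
      B (2 * j) (((j : ℝ) + 1) • (w (e i) (f i) • s ^ j - ι ℝ (e i) * ctr (w.flip (f i)) (s ^ j)))
        (s ^ j) := by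
    intro i
    rw [B_right w B hB (e i) hx (mul_mem_Lam _ hy),
      B_right w B hB (f i) ((ctr_mem _ hx).1 _ rfl) hy, ctr_two_pow w e f hid, map_smul, ctr_mul]
    rfl
  have h3 : ∑ i, (ι ℝ (e i) * ctr (w.flip (f i)) (s ^ j)) = (j : ℝ) • s ^ j := by
    cases j with
    | zero => simp [ctr_one]
    | succ j =>
      simp only [hs, ctr_two_pow w e f hid]
      rw [pow_succ' _ j]
      have h0 : two e f * two e f ^ j = (∑ i, ι ℝ (e i) * ι ℝ (f i)) * two e f ^ j := rfl
      rw [h0, Finset.sum_mul, Finset.smul_sum]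
      refine Finset.sum_congr rfl fun i _ => ?_
      rw [mul_smul_comm, mul_assoc]; push_cast; rfl
  have h4 : B (2 * (j + 1)) (s ^ (j + 1)) (s ^ (j + 1)) =
      B (2 * j + 1 + 1) (s ^ (j + 1)) (∑ i, ι ℝ (e i) * (ι ℝ (f i) * s ^ j)) := by
    rw [← h1]; rfl
  rw [h4, map_sum]
  simp only [h2]
  rw [← LinearMap.sum_apply, ← map_sum, ← Finset.smul_sum, Finset.sum_sub_distrib, h3,
    ← Finset.sum_smul, trace_two w hsk e f hid hdim, ← sub_smul, smul_smul, map_smul]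
  rfl

include hid hsk hB in
theorem B_two_pow [FiniteDimensional ℝ M] {n : ℕ} (hdim : Module.finrank ℝ M = 2 * n) (j : ℕ)
    (hj : j ≤ n) :
    B (2 * j) (two e f ^ j) (two e f ^ j) * (n - j).factorial = j.factorial * n.factorial := by
  induction j with
  | zero =>
    have := hB 0 Fin.elim0 Fin.elim0
    simp at this
    simp [this]
  | succ j ih =>
    have ih := ih (by omega)
    obtain ⟨i, rfl⟩ : ∃ i, n = j + 1 + i := ⟨n - (j + 1), by omega⟩
    rw [B_two_pow_succ w hsk e f hid B hB hdim]
    have e1 : j + 1 + i - (j + 1) = i := by omega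
    have e2 : j + 1 + i - j = i + 1 := by omega
    rw [e2, Nat.factorial_succ i] at ih
    rw [e1, Nat.factorial_succ j]
    push_cast at ih ⊢
    linear_combination ((j : ℝ) + 1) * ih

include hid hsk in
theorem euler {k : ℕ} {x : ExteriorAlgebra ℝ M} (hx : x ∈ Lam M k) :
    ∑ i, (ι ℝ (e i) * ctr (w.flip (f i)) x - ι ℝ (f i) * ctr (w.flip (e i)) x) = (k : ℝ) • x := by
  induction k, x, hx using Lam_ind with
  | h0 r => simp [ctr_alg]
  | hadd k x y _ _ hx hy =>
    rw [smul_add, ← hx, ← hy, ← Finset.sum_add_distrib]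
    refine Finset.sum_congr rfl fun i _ => ?_
    simp only [map_add, mul_add]; abel
  | hmul u k x hx ih =>
    have h1 : ∀ i, (ι ℝ (e i) * ctr (w.flip (f i)) (ι ℝ u * x) -
        ι ℝ (f i) * ctr (w.flip (e i)) (ι ℝ u * x)) =
        ι ℝ (w (e i) u • f i - w (f i) u • e i) * x +
        ι ℝ u * (ι ℝ (e i) * ctr (w.flip (f i)) x - ι ℝ (f i) * ctr (w.flip (e i)) x) := by
      intro i
      have ha : ∀ a : M, ∀ y, ι ℝ a * (ι ℝ u * y) = - (ι ℝ u * (ι ℝ a * y)) := by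
        intro a y; rw [← mul_assoc, ι_swap, neg_mul, mul_assoc]
      have hfl : ∀ a, w.flip a u = - w a u := fun a => hsk u a
      simp only [ctr_mul, mul_sub, ha, hfl, map_sub, map_smul, sub_mul,
        smul_mul_assoc, mul_smul_comm]
      module
    simp only [h1]
    rw [Finset.sum_add_distrib, ← Finset.mul_sum, ih, ← Finset.sum_mul, ← map_sum, hid]
    simp only [mul_smul_comm]
    push_cast
    module

include hid hsk in
theorem pairing_nondeg [FiniteDimensional ℝ M] {n : ℕ} (hdim : Module.finrank ℝ M = 2 * n)
    (hvol : two e f ^ n ≠ 0) (p : ℕ) : ∀ k, k + p = 2 * n → ∀ x ∈ Lam M p,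
      (∀ y ∈ Lam M k, y * x = 0) → x = 0 := by
  induction p with
  | zero =>
    intro k hk x hx h
    rw [Lam, pow_zero] at hx
    obtain ⟨r, rfl⟩ := Submodule.mem_one.1 hx
    have := h (two e f ^ n) (by convert two_pow_mem e f n; omega)
    rw [← Algebra.commutes, ← Algebra.smul_def] at this
    rw [(smul_eq_zero.1 this).resolve_right hvol, map_zero]
  | succ p ih =>
    intro k hk x hx h
    have key : ∀ d, ctr d x = 0 := by
      intro d
      refine ih (k + 1) (by omega) _ ((ctr_mem d hx).1 p rfl) fun y hy => ?_
      have h1 : y * x = 0 := Lam_top (k := k + 1 + (p + 1)) (by omega) (mul_mem_Lam' hy hx)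
      have h2 := ctr_mul' d hy x
      rw [h1, h _ ((ctr_mem d hy).1 k rfl), map_zero, zero_add] at h2
      exact (smul_eq_zero.1 h2.symm).resolve_left (by simp)
    have := euler w hsk e f hid hx
    simp only [key, mul_zero, sub_zero, Finset.sum_const_zero] at this
    refine (smul_eq_zero.1 this.symm).resolve_left ?_
    positivity

include hid hsk hB in
theorem main [FiniteDimensional ℝ M] {n : ℕ} (hdim : Module.finrank ℝ M = 2 * n)
    (star : ExteriorAlgebra ℝ M →ₗ[ℝ] ExteriorAlgebra ℝ M)
    (hdeg : ∀ k : ℕ, k ≤ 2 * n → ∀ α ∈ Lam M k, star α ∈ Lam M (2 * n - k))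
    (hstar : ∀ k : ℕ, k ≤ 2 * n → ∀ α β, α ∈ Lam M k → β ∈ Lam M k →
      α * star β = (B k α β) • ((n.factorial : ℝ)⁻¹ • two e f ^ n))
    (k : ℕ) (x : ExteriorAlgebra ℝ M) (hx : x ∈ Lam M k) (hk : k ≤ 2 * n) :
    star (star x) = x := by
  have hBn := B_two_pow w hsk e f hid B hB hdim n le_rfl
  simp only [Nat.sub_self, Nat.factorial_zero, Nat.cast_one, mul_one] at hBn
  have hfac : (n.factorial : ℝ) ≠ 0 := by positivity
  have hvol : two e f ^ n ≠ 0 := by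
    intro h
    rw [h] at hBn
    simp at hBn
    exact hfac (by exact_mod_cast hBn)
  set vol := (n.factorial : ℝ)⁻¹ • two e f ^ n with hvoldef
  have hvol0 : vol ≠ 0 := smul_ne_zero (inv_ne_zero hfac) hvol
  have hvolmem : vol ∈ Lam M (2 * n) := Submodule.smul_mem _ _ (two_pow_mem e f n)
  have hBvol : B (2 * n) vol vol = 1 := by
    rw [hvoldef, map_smul, map_smul, LinearMap.smul_apply, hBn, smul_eq_mul, smul_eq_mul]
    field_simp
  have hB0 : B 0 1 1 = 1 := by
    have := hB 0 Fin.elim0 Fin.elim0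
    simpa using this
  have one_mem : (1 : ExteriorAlgebra ℝ M) ∈ Lam M 0 := by
    simpa using alg_mem (M := M) 1
  have star_one : star 1 = vol := by
    have := hstar 0 (Nat.zero_le _) 1 1 one_mem one_mem
    rwa [one_mul, hB0, one_smul] at this
  have star_vol : star vol = 1 := by
    have h1 := hdeg _ le_rfl vol hvolmem
    rw [Nat.sub_self, Lam, pow_zero] at h1
    obtain ⟨r, hr⟩ := Submodule.mem_one.1 h1
    have h2 := hstar _ le_rfl vol vol hvolmem hvolmem
    rw [hBvol, ← hr, ← Algebra.commutes, ← Algebra.smul_def] at h2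
    have : r = 1 := smul_left_injective ℝ hvol0 h2
    rw [← hr, this, map_one]
  -- star of a wedge
  have A : ∀ (k : ℕ) (v : M) (x), x ∈ Lam M k → k + 1 ≤ 2 * n →
      star (ι ℝ v * x) = (-1 : ℝ) ^ k • ctr (w.flip v) (star x) := by
    intro k v x hx hk
    rw [← sub_eq_zero]
    have hsx := hdeg k (by omega) x hx
    refine pairing_nondeg w hsk e f hid hdim hvol (2 * n - (k + 1)) (k + 1) (by omega) _
      (Submodule.sub_mem _ (hdeg _ hk _ (mul_mem_Lam v hx)) (Submodule.smul_mem _ _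
        ((ctr_mem _ hsx).1 _ (by omega)))) fun y hy => ?_
    rw [mul_sub, hstar _ hk _ _ hy (mul_mem_Lam v hx), B_right w B hB v hy hx,
      ← hstar k (by omega) _ _ ((ctr_mem _ hy).1 k rfl) hx]
    have h0 : y * star x = 0 := Lam_top (k := k + 1 + (2 * n - k)) (by omega) (mul_mem_Lam' hy hsx)
    have h1 := ctr_mul' (w.flip v) hy (star x)
    rw [h0, map_zero, pow_succ] at h1
    rw [mul_smul_comm, h1]
    module
  -- star of a contraction
  have C : ∀ (k : ℕ) (v : M) (x), x ∈ Lam M (k + 1) → k + 1 ≤ 2 * n →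
      star (ctr (w.flip v) x) = (-1 : ℝ) ^ (k + 1) • (ι ℝ v * star x) := by
    intro k v x hx hk
    rw [← sub_eq_zero]
    have hsx := hdeg (k + 1) hk x hx
    have hcx := (ctr_mem (w.flip v) hx).1 k rfl
    have hmem : ι ℝ v * star x ∈ Lam M (2 * n - k) := by
      have := mul_mem_Lam v hsx
      rwa [show 2 * n - (k + 1) + 1 = 2 * n - k by omega] at this
    refine pairing_nondeg w hsk e f hid hdim hvol (2 * n - k) k (by omega) _
      (Submodule.sub_mem _ (hdeg _ (by omega) _ hcx) (Submodule.smul_mem _ _ hmem)) fun y hy => ?_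
    have hfl : w.flip v = - w v := by
      ext u; simp [hsk u v]
    rw [mul_sub, hstar k (by omega) _ _ hy hcx, hfl, ctr_neg, map_neg, ← B_left w B hB v hx hy,
      neg_smul, ← hstar (k + 1) hk _ _ (mul_mem_Lam v hy) hx, Lam_comm v hy, mul_smul_comm,
      ← mul_assoc, pow_succ, smul_mul_assoc]
    module
  induction k, x, hx using Lam_ind with
  | h0 r => rw [Algebra.algebraMap_eq_smul_one, map_smul, map_smul, star_one, star_vol]
  | hadd k x y _ _ hx hy => rw [map_add, map_add, hx hk, hy hk]
  | hmul v k x hx ih =>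
    have hsx := hdeg k (by omega) x hx
    obtain ⟨j, hj⟩ : ∃ j, 2 * n - k = j + 1 := ⟨2 * n - k - 1, by omega⟩
    rw [hj] at hsx
    rw [A k v x hx hk, map_smul, C j v _ hsx (by omega), ih (by omega), smul_smul, ← pow_add,
      show k + (j + 1) = 2 * n by omega, pow_mul]
    simp

end
end
end SympStar
/-- let V be a 2n-dimensional real vector space with a nondegenerate
alternating bilinear form ω. Let ω⁻¹ be the induced bilinear form on V* (so that
ω⁻¹(ω♭u, ω♭v) = ω(u,v)), extended to k-forms by
ω⁻¹(α₁∧…∧αₖ, β₁∧…∧βₖ) = det(ω⁻¹(αᵢ,βⱼ)) (here the family `B`), let ωform ∈ Λ²V* be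
the 2-form corresponding to ω, and let `star` be the symplectic star operator,
characterized on k-forms by α ∧ *β = ω⁻¹(α,β) ωⁿ/n! and mapping k-forms to
(2n-k)-forms. Then *∘* = id. -/
theorem stmt12 (n : ℕ) (hn : 0 < n)
    (V : Type) [AddCommGroup V] [Module ℝ V] [FiniteDimensional ℝ V]
    (hdim : Module.finrank ℝ V = 2 * n)
    (ω : LinearMap.BilinForm ℝ V) (halt : ω.IsAlt) (hnd : ω.Nondegenerate)
    (ωinv : LinearMap.BilinForm ℝ (Module.Dual ℝ V))
    (hωinv : ∀ u v : V, ωinv (ω u) (ω v) = ω u v)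
    (B : ℕ → LinearMap.BilinForm ℝ (ExteriorAlgebra ℝ (Module.Dual ℝ V)))
    (hB : ∀ k : ℕ, ∀ α β : Fin k → Module.Dual ℝ V,
      B k ((List.ofFn fun i => ExteriorAlgebra.ι ℝ (α i)).prod)
          ((List.ofFn fun i => ExteriorAlgebra.ι ℝ (β i)).prod)
        = Matrix.det (Matrix.of fun i j => ωinv (α i) (β j)))
    (ωform : ExteriorAlgebra ℝ (Module.Dual ℝ V))
    (hωformdeg : ωform ∈
      (LinearMap.range (ExteriorAlgebra.ι ℝ :
          Module.Dual ℝ V →ₗ[ℝ] ExteriorAlgebra ℝ (Module.Dual ℝ V)) ^ 2 :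
        Submodule ℝ (ExteriorAlgebra ℝ (Module.Dual ℝ V))))
    (hωformval : ∀ u v : V,
      B 2 (ExteriorAlgebra.ι ℝ (ω u) * ExteriorAlgebra.ι ℝ (ω v)) ωform = ω u v)
    (star : ExteriorAlgebra ℝ (Module.Dual ℝ V) →ₗ[ℝ] ExteriorAlgebra ℝ (Module.Dual ℝ V))
    (hstardeg : ∀ k : ℕ, k ≤ 2 * n → ∀ α ∈
      (LinearMap.range (ExteriorAlgebra.ι ℝ :
          Module.Dual ℝ V →ₗ[ℝ] ExteriorAlgebra ℝ (Module.Dual ℝ V)) ^ k :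
        Submodule ℝ (ExteriorAlgebra ℝ (Module.Dual ℝ V))),
      star α ∈
      (LinearMap.range (ExteriorAlgebra.ι ℝ :
          Module.Dual ℝ V →ₗ[ℝ] ExteriorAlgebra ℝ (Module.Dual ℝ V)) ^ (2 * n - k) :
        Submodule ℝ (ExteriorAlgebra ℝ (Module.Dual ℝ V))))
    (hstar : ∀ k : ℕ, k ≤ 2 * n → ∀ α β, α ∈
      (LinearMap.range (ExteriorAlgebra.ι ℝ :
          Module.Dual ℝ V →ₗ[ℝ] ExteriorAlgebra ℝ (Module.Dual ℝ V)) ^ k :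
        Submodule ℝ (ExteriorAlgebra ℝ (Module.Dual ℝ V))) → β ∈
      (LinearMap.range (ExteriorAlgebra.ι ℝ :
          Module.Dual ℝ V →ₗ[ℝ] ExteriorAlgebra ℝ (Module.Dual ℝ V)) ^ k :
        Submodule ℝ (ExteriorAlgebra ℝ (Module.Dual ℝ V))) →
      α * star β = (B k α β) • ((n.factorial : ℝ)⁻¹ • ωform ^ n)) :
    ∀ k : ℕ, k ≤ 2 * n → ∀ α ∈
      (LinearMap.range (ExteriorAlgebra.ι ℝ :
          Module.Dual ℝ V →ₗ[ℝ] ExteriorAlgebra ℝ (Module.Dual ℝ V)) ^ k :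
        Submodule ℝ (ExteriorAlgebra ℝ (Module.Dual ℝ V))),
      star (star α) = α := by
  have hsurj : ∀ a : Module.Dual ℝ V, ∃ u, ω u = a := by
    have hinj : Function.Injective ω := LinearMap.ker_eq_bot.1 hnd.ker_eq_bot
    exact (LinearMap.injective_iff_surjective_of_finrank_eq_finrank
      (Subspace.dual_finrank_eq (K := ℝ) (V := V)).symm).1 hinj
  have hsk : ∀ a b, ωinv a b = - ωinv b a := by
    intro a b
    obtain ⟨u, rfl⟩ := hsurj a
    obtain ⟨v, rfl⟩ := hsurj b
    rw [hωinv, hωinv, LinearMap.BilinForm.IsAlt.neg_eq halt]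
  have hnd' : ∀ b, (∀ a, ωinv a b = 0) → b = 0 := by
    intro b h
    obtain ⟨v, rfl⟩ := hsurj b
    ext u
    have := h (ω u)
    rw [hωinv] at this
    rw [← LinearMap.BilinForm.IsAlt.neg_eq halt, this]; simp
  obtain ⟨m, e, f, hef⟩ := SympStar.deg_two_rep hωformdeg
  have hef : ωform = SympStar.two e f := hef
  subst hef
  have hid : ∀ u, ∑ i, (ωinv (e i) u • f i - ωinv (f i) u • e i) = u := by
    intro a
    rw [← sub_eq_zero]
    refine hnd' _ fun b => ?_
    obtain ⟨u, rfl⟩ := hsurj a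
    obtain ⟨v, rfl⟩ := hsurj b
    have h1 := hωformval u v
    rw [SympStar.B_left ωinv B hB _ (SympStar.two_mem e f) (SympStar.ι_mem _),
      SympStar.ctr_two_aux] at h1
    have h2 : ∀ a b, B 1 (ι ℝ a) (ι ℝ b) = ωinv a b := by
      intro a b
      have := hB 1 (fun _ => a) (fun _ => b)
      simpa using this
    rw [h2, ← hωinv] at h1
    have h3 : ∑ i, (ωinv (ω u) (e i) • f i - ωinv (ω u) (f i) • e i) =
        - ∑ i, (ωinv (e i) (ω u) • f i - ωinv (f i) (ω u) • e i) := by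
      rw [← Finset.sum_neg_distrib]
      refine Finset.sum_congr rfl fun i _ => ?_
      rw [hsk (ω u), hsk (ω u)]
      module
    rw [h3, map_neg, hsk (ω u)] at h1
    rw [map_sub]
    linarith
  intro k hk α hα
  exact SympStar.main ωinv hsk e f hid B hB (by rw [Subspace.dual_finrank_eq, hdim]) star hstardeg
    hstar k α hα hk
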